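/- For the distributed proximal gradient algorithm, the series ∑_{k=2}^∞ ‖e_{k+1}‖ · ‖x̄_{k+1} − x̄_k‖ converges, where x̄_k = (1/m)∑_{i=1}^m x_{i,k} and e_{k+1} = (1/m)∑_{i=1}^m (∇g_i(x_{i,k}) − ∇g_i(x̄_k)). -/

import Mathlib

open scoped RealInnerProductSpace
open Filter

section Prox

variable {E : Type*} [NormedAddCommGroup E] [InnerProductSpace ℝ E]

/-- A minimizer `p` of `h + ‖· - w‖² / (2α)` has `(w - p) / α` as a subgradient of `h` at `p`. -/
theorem ConvexOn.subgradient_of_prox {h : E → ℝ} (hconv : ConvexOn ℝ Set.univ h) {α : ℝ}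
    (hα : 0 < α) {w p : E}
    (hp : ∀ z, h p + (1 / (2 * α)) * ‖p - w‖ ^ 2 ≤ h z + (1 / (2 * α)) * ‖z - w‖ ^ 2) (u : E) :
    h p + ⟪α⁻¹ • (w - p), u - p⟫ ≤ h u := by
  set a := h p + ⟪α⁻¹ • (w - p), u - p⟫ - h u with ha
  set c := 1 / (2 * α) * ‖u - p‖ ^ 2 with hc
  have hc0 : 0 ≤ c := by positivity
  have key : ∀ t : ℝ, 0 < t → t ≤ 1 → a ≤ t * c := by
    intro t ht ht1
    have hz := hp ((1 - t) • p + t • u)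
    have hcv := hconv.2 (Set.mem_univ p) (Set.mem_univ u) (sub_nonneg.2 ht1) ht.le (by ring)
    have hsplit : (1 - t) • p + t • u - w = t • (u - p) - (w - p) := by module
    rw [hsplit, norm_sub_sq_real (t • (u - p)), norm_smul, mul_pow, Real.norm_eq_abs, sq_abs,
      real_inner_smul_left, norm_sub_rev p w, real_inner_comm (w - p)] at hz
    simp only [smul_eq_mul] at hcv
    have hmul : t * a ≤ t * (t * c) := by
      rw [ha, hc, real_inner_smul_left]
      have hhalf : 1 / (2 * α) * (t ^ 2 * ‖u - p‖ ^ 2 - 2 * (t * ⟪w - p, u - p⟫) + ‖w - p‖ ^ 2)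
          = t * (t * (1 / (2 * α) * ‖u - p‖ ^ 2)) - t * (α⁻¹ * ⟪w - p, u - p⟫)
            + 1 / (2 * α) * ‖w - p‖ ^ 2 := by
        field_simp
      rw [hhalf] at hz
      linarith
    exact le_of_mul_le_mul_left hmul ht
  have ha0 : a ≤ 0 := by
    by_contra! hpos
    have := key (a / (a + c)) (by positivity) (div_le_one_of_le₀ (by linarith) (by positivity))
    rw [div_mul_eq_mul_div, le_div_iff₀ (by positivity)] at this
    nlinarith
  linarith

/-- Points satisfying the proximal optimality inequalities depend nonexpansively on the base. -/
theorem norm_sub_le_of_prox_subgradient {h : E → ℝ} {α : ℝ} (hα : 0 < α) {w w' p p' : E}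
    (hp : ∀ u, h p + ⟪α⁻¹ • (w - p), u - p⟫ ≤ h u)
    (hp' : ∀ u, h p' + ⟪α⁻¹ • (w' - p'), u - p'⟫ ≤ h u) :
    ‖p - p'‖ ≤ ‖w - w'‖ := by
  have h1 := hp p'
  have h2 := hp' p
  rw [real_inner_smul_left] at h1 h2
  have h3 : α⁻¹ * (⟪w - p, p' - p⟫ + ⟪w' - p', p - p'⟫) ≤ 0 := by linarith
  have h4 : ⟪w - p, p' - p⟫ + ⟪w' - p', p - p'⟫ ≤ 0 :=
    nonpos_of_mul_nonpos_right h3 (inv_pos.2 hα)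
  have h5 : ⟪w - p, p' - p⟫ + ⟪w' - p', p - p'⟫ = ‖p - p'‖ ^ 2 - ⟪w - w', p - p'⟫ := by
    rw [← real_inner_self_eq_norm_sq]
    simp only [inner_sub_left, inner_sub_right]
    ring
  have h6 := real_inner_le_norm (w - w') (p - p')
  by_contra! hlt
  nlinarith [norm_nonneg (w - w')]

end Prox

section Average

variable {E : Type*} [NormedAddCommGroup E] [NormedSpace ℝ E]

theorem norm_average_le {m : ℕ} (hm : 1 ≤ m) {y : Fin m → E} {D : ℝ} (hy : ∀ i, ‖y i‖ ≤ D) :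
    ‖(m : ℝ)⁻¹ • ∑ i, y i‖ ≤ D := by
  have hm0 : (0 : ℝ) < m := by exact_mod_cast hm
  have hsum : ‖∑ i, y i‖ ≤ m * D := by
    simpa using norm_sum_le_of_le Finset.univ (fun i _ => hy i)
  rw [norm_smul, Real.norm_of_nonneg (by positivity), inv_mul_le_iff₀ hm0]
  exact hsum

theorem norm_sub_average_le {m : ℕ} (hm : 1 ≤ m) {y : Fin m → E} {D : ℝ}
    (hy : ∀ i j, ‖y i - y j‖ ≤ D) (i : Fin m) :
    ‖y i - (m : ℝ)⁻¹ • ∑ j, y j‖ ≤ D := by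
  have hm0 : (m : ℝ) ≠ 0 := by exact_mod_cast (by omega : m ≠ 0)
  have hrw : y i - (m : ℝ)⁻¹ • ∑ j, y j = (m : ℝ)⁻¹ • ∑ j, (y i - y j) := by
    rw [Finset.sum_sub_distrib, smul_sub, Finset.sum_const, Finset.card_univ, Fintype.card_fin,
      ← Nat.cast_smul_eq_nsmul ℝ, smul_smul, inv_mul_cancel₀ hm0, one_smul]
  rw [hrw]
  exact norm_average_le hm (hy i)

/-- Mixing with nonnegative weights of unit column sums does not increase the sum of norms. -/
theorem sum_norm_sum_smul_le {ι : Type*} [Fintype ι] {w : ι → ι → ℝ} (hw : ∀ i j, 0 ≤ w i j)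
    (hcol : ∀ j, ∑ i, w i j = 1) (y : ι → E) :
    ∑ i, ‖∑ j, w i j • y j‖ ≤ ∑ j, ‖y j‖ :=
  calc ∑ i, ‖∑ j, w i j • y j‖ ≤ ∑ i, ∑ j, w i j * ‖y j‖ := by
        refine Finset.sum_le_sum fun i _ => norm_sum_le_of_le _ fun j _ => ?_
        rw [norm_smul, Real.norm_of_nonneg (hw i j)]
    _ = ∑ j, ‖y j‖ := by
        rw [Finset.sum_comm]
        simp only [← Finset.sum_mul, hcol, one_mul]

/-- Weights that are uniformly close to a constant produce nearly equal mixtures. -/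
theorem norm_sum_smul_sub_sum_smul_le {ι : Type*} [Fintype ι] {w : ι → ι → ℝ} {c δ : ℝ}
    (hw : ∀ i j, |w i j - c| ≤ δ) (y : ι → E) (i i' : ι) :
    ‖∑ j, w i j • y j - ∑ j, w i' j • y j‖ ≤ 2 * δ * ∑ j, ‖y j‖ := by
  rw [← Finset.sum_sub_distrib, Finset.mul_sum]
  refine norm_sum_le_of_le _ fun j _ => ?_
  rw [← sub_smul, norm_smul, Real.norm_eq_abs]
  gcongr
  have h1 := abs_le.1 (hw i j)
  have h2 := abs_le.1 (hw i' j)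
  exact abs_le.2 ⟨by linarith, by linarith⟩

end Average

theorem stmt_12
    (n m : ℕ) (hn : 0 < n) (hm : 1 ≤ m)
    (g : Fin m → EuclideanSpace ℝ (Fin n) → ℝ)
    (G : Fin m → EuclideanSpace ℝ (Fin n) → EuclideanSpace ℝ (Fin n))
    (L Gg Gh α : ℝ) (hL : 0 < L)
    (hgrad : ∀ i x, HasGradientAt (g i) (G i x) x)
    (hLip : ∀ i x y, ‖G i x - G i y‖ ≤ L * ‖x - y‖)
    (hGg : ∀ i x, ‖G i x‖ ≤ Gg)
    (h : EuclideanSpace ℝ (Fin n) → ℝ)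
    (hconv : ConvexOn ℝ Set.univ h)
    (hGh : 0 < Gh)
    (hsub : ∀ x z : EuclideanSpace ℝ (Fin n), (∀ u, h x + ⟪z, u - x⟫ ≤ h u) → ‖z‖ ≤ Gh)
    (hα0 : 0 < α) (hα1 : α < 1 / L)
    (prox : EuclideanSpace ℝ (Fin n) → EuclideanSpace ℝ (Fin n))
    (hprox : ∀ w z, h (prox w) + (1 / (2 * α)) * ‖prox w - w‖ ^ 2
      ≤ h z + (1 / (2 * α)) * ‖z - w‖ ^ 2)
    (hproxuniq : ∀ w z, (∀ u, h z + (1 / (2 * α)) * ‖z - w‖ ^ 2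
      ≤ h u + (1 / (2 * α)) * ‖u - w‖ ^ 2) → z = prox w)
    (lam : ℕ → Fin m → Fin m → ℝ) (Γ γ : ℝ) (hΓ : 0 < Γ) (hγ0 : 0 < γ) (hγ1 : γ < 1)
    (hlamnn : ∀ k, 2 ≤ k → ∀ i j, 0 ≤ lam k i j)
    (hrow : ∀ k, 2 ≤ k → ∀ i, ∑ j, lam k i j = 1)
    (hcol : ∀ k, 2 ≤ k → ∀ j, ∑ i, lam k i j = 1)
    (hmix : ∀ k, 2 ≤ k → ∀ i j, |lam k i j - 1 / (m : ℝ)| ≤ Γ * γ ^ k)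
    (x q v : ℕ → Fin m → EuclideanSpace ℝ (Fin n))
    (hq : ∀ k, 1 ≤ k → ∀ i, q (k + 1) i = x k i - α • G i (x k i))
    (hv : ∀ k, 1 ≤ k → ∀ i, v (k + 1) i = ∑ j, lam (k + 1) i j • q (k + 1) j)
    (hx : ∀ k, 1 ≤ k → ∀ i, x (k + 1) i = prox (v (k + 1) i))
    (xbar : ℕ → EuclideanSpace ℝ (Fin n))
    (hxbar : ∀ k, xbar k = (m : ℝ)⁻¹ • ∑ i, x k i)
    (e : ℕ → EuclideanSpace ℝ (Fin n))
    (he : ∀ k, 1 ≤ k → e (k + 1) = (m : ℝ)⁻¹ • ∑ i, (G i (x k i) - G i (xbar k)))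
    :
    Summable (fun k : ℕ => ‖e (k + 3)‖ * ‖xbar (k + 3) - xbar (k + 2)‖) := by
  have hsg : ∀ w u, h (prox w) + ⟪α⁻¹ • (w - prox w), u - prox w⟫ ≤ h u := fun w =>
    hconv.subgradient_of_prox hα0 (hprox w)
  have hdisp : ∀ w, ‖prox w‖ ≤ ‖w‖ + α * Gh := by
    intro w
    have h1 := hsub _ _ (hsg w)
    rw [norm_smul, Real.norm_of_nonneg (by positivity), inv_mul_le_iff₀ hα0] at h1
    have h2 := norm_sub_norm_le (prox w) w
    rw [norm_sub_rev] at h2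
    linarith
  have hGg0 : 0 ≤ Gg := (norm_nonneg _).trans (hGg ⟨0, hm⟩ 0)
  set S : ℕ → ℝ := fun k => ∑ i, ‖x k i‖ with hS
  have hS0 : ∀ k, 0 ≤ S k := fun k => Finset.sum_nonneg fun i _ => norm_nonneg _
  have hqS : ∀ k, 1 ≤ k → ∑ i, ‖q (k + 1) i‖ ≤ S k + m * (α * Gg) := by
    intro k hk
    have : ∀ i, ‖q (k + 1) i‖ ≤ ‖x k i‖ + α * Gg := by
      intro i
      rw [hq k hk i]
      refine (norm_sub_le _ _).trans ?_
      rw [norm_smul, Real.norm_of_nonneg hα0.le]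
      gcongr
      exact hGg _ _
    refine (Finset.sum_le_sum fun i _ => this i).trans_eq ?_
    simp [Finset.sum_add_distrib, hS]
  have hSstep : ∀ k, 1 ≤ k → S (k + 1) ≤ S k + m * (α * Gg) + m * (α * Gh) := by
    intro k hk
    have h1 : S (k + 1) ≤ ∑ i, ‖v (k + 1) i‖ + m * (α * Gh) := by
      refine (Finset.sum_le_sum fun i _ => (hx k hk i ▸ hdisp (v (k + 1) i) :
        ‖x (k + 1) i‖ ≤ ‖v (k + 1) i‖ + α * Gh)).trans_eq ?_
      simp [Finset.sum_add_distrib]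
    have h2 := sum_norm_sum_smul_le (hlamnn (k + 1) (by omega)) (hcol (k + 1) (by omega))
      (q (k + 1))
    simp only [hv k hk] at h1
    linarith [hqS k hk]
  set B : ℝ := S 1 + (m * (α * Gg) + m * (α * Gh)) with hB
  have hmg : 0 ≤ m * (α * Gg) := by positivity
  have hmh : 0 ≤ m * (α * Gh) := by positivity
  have hB0 : 0 ≤ B := by linarith [hS0 1]
  have hSB : ∀ k, 1 ≤ k → S k ≤ B * k := by
    intro k hk
    induction k, hk using Nat.le_induction with
    | base => simp only [Nat.cast_one, mul_one]; linarith
    | succ k hk ih =>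
      push_cast
      linarith [hSstep k hk, hS0 1]
  have hconsensus : ∀ k, 1 ≤ k → ∀ i j,
      ‖x (k + 1) i - x (k + 1) j‖ ≤ 2 * (Γ * γ ^ (k + 1)) * (B * (k + 1)) := by
    intro k hk i j
    rw [hx k hk, hx k hk]
    refine (norm_sub_le_of_prox_subgradient hα0 (hsg _) (hsg _)).trans ?_
    rw [hv k hk, hv k hk]
    refine (norm_sum_smul_sub_sum_smul_le (hmix (k + 1) (by omega)) _ i j).trans ?_
    gcongr
    linarith [hqS k hk, hSB k hk, hS0 1]
  have hebound : ∀ k, 1 ≤ k →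
      ‖e (k + 2)‖ ≤ L * (2 * (Γ * γ ^ (k + 1)) * (B * (k + 1))) := by
    intro k hk
    rw [he (k + 1) (by omega)]
    refine norm_average_le hm fun i => (hLip i _ _).trans ?_
    gcongr
    rw [hxbar]
    exact norm_sub_average_le hm (hconsensus k hk) i
  have hxbarB : ∀ k, 1 ≤ k → ‖xbar k‖ ≤ B * k := by
    intro k hk
    rw [hxbar]
    exact norm_average_le hm fun i => (Finset.single_le_sum (f := fun i => ‖x k i‖)
      (fun i _ => norm_nonneg _) (Finset.mem_univ i)).trans (hSB k hk)
  have hsum : Summable fun k : ℕ => 4 * L * Γ * B ^ 2 * γ⁻¹ *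
      (((k + 3 : ℕ) : ℝ) ^ 2 * γ ^ (k + 3)) := by
    have hgeom : Summable fun k : ℕ => (k : ℝ) ^ 2 * γ ^ k :=
      summable_pow_mul_geometric_of_norm_lt_one 2 (by rwa [Real.norm_of_nonneg hγ0.le])
    exact (hgeom.comp_injective (add_left_injective 3)).mul_left _
  refine Summable.of_nonneg_of_le (fun k => by positivity) (fun k => ?_) hsum
  have h1 : ‖e (k + 3)‖ ≤ L * (2 * (Γ * γ ^ (k + 2)) * (B * (k + 3))) := by
    refine (hebound (k + 1) (by omega)).trans ?_
    push_cast
    gcongr L * (2 * (Γ * γ ^ (k + 2)) * (B * ?_))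
    linarith
  have h2 : ‖xbar (k + 3) - xbar (k + 2)‖ ≤ 2 * (B * (k + 3)) := by
    have h3 := hxbarB (k + 3) (by omega)
    have h4 := hxbarB (k + 2) (by omega)
    push_cast at h3 h4
    linarith [norm_sub_le (xbar (k + 3)) (xbar (k + 2))]
  refine (mul_le_mul h1 h2 (norm_nonneg _) (by positivity)).trans_eq ?_
  push_cast
  field_simp
  ring
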